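/- In the free-fermion case η = π/4 (so α = 2), μ = 0, the NE arctic-curve parametrization degenerates to a straight segment as λ → π/4 from below: for every ξ ∈ (0, π/2), lim_{ε→0⁺} X_NE(ξ)|_{λ=π/4−ε} = (2·cos(2ξ) − 3)/4 and lim_{ε→0⁺} Y_NE(ξ)|_{λ=π/4−ε} = (5 − 2·cos(2ξ))/4. -/

import Mathlib

open Real

/-- The inverse slope `A(ξ) = s(ξ)⁻¹` of the family of tangent lines in the Tangent
Method for the 20V model with DWBC3. -/
noncomputable def A20V (η lam mu ξ : ℝ) : ℝ :=
  (sin (ξ + lam + η) * sin (ξ + lam - η) / (sin ξ * sin (ξ + 2 * η))) *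
    ((sin ξ * sin (ξ + 2 * η) +
        sin (ξ + (lam - η + mu) / 2) * sin (ξ + (lam + 3 * η + mu) / 2)) /
      (sin (ξ + lam + η) * sin (ξ + lam - η) +
        sin (ξ + (lam - η + mu) / 2) * sin (ξ + (lam + 3 * η + mu) / 2)))

/-- The saddle-point exit position `κ(ξ)` of the Tangent Method for the 20V model
with DWBC3, with `α = π/(π - 2η)`. -/
noncomputable def kappa20V (η lam mu ξ : ℝ) : ℝ :=
  (2 * cot (ξ + lam - η) - cot ξ - cot (ξ + lam + η) +
      (π / (π - 2 * η)) * cot ((π / (π - 2 * η)) * ξ) -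
      (π / (π - 2 * η)) * cot ((π / (π - 2 * η)) * (ξ + lam - η))) *
    (sin (ξ + lam + η) * sin (ξ + lam - η) * sin (ξ + (lam - η + mu) / 2) *
      sin (ξ + (lam + 3 * η + mu) / 2)) /
    (sin (2 * η) *
      (sin (ξ + lam + η) * sin (ξ + lam - η) +
        sin (ξ + (lam - η + mu) / 2) * sin (ξ + (lam + 3 * η + mu) / 2)))

/-- The `x`-coordinate of the NE branch of the arctic curve (envelope of the family
of tangent lines): `X_NE(ξ) = κ'(ξ)/A'(ξ)`. -/
noncomputable def Xne (η lam mu ξ : ℝ) : ℝ :=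
  deriv (kappa20V η lam mu) ξ / deriv (A20V η lam mu) ξ

/-- The `y`-coordinate of the NE branch of the arctic curve:
`Y_NE(ξ) = κ(ξ) - A(ξ)·κ'(ξ)/A'(ξ)`. -/
noncomputable def Yne (η lam mu ξ : ℝ) : ℝ :=
  kappa20V η lam mu ξ - A20V η lam mu ξ * Xne η lam mu ξ

open Filter Topology

/-- `S t = sin t cos t`. -/
noncomputable def Sf (t : ℝ) : ℝ := sin t * cos t
/-- derivative of `Sf` -/
noncomputable def Sd (t : ℝ) : ℝ := cos t * cos t - sin t * sin t
noncomputable def Gf (t : ℝ) : ℝ := cos t / sin t + 2 * (sin t / cos t)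
noncomputable def Gd (t : ℝ) : ℝ :=
  -(sin t ^ 2 + cos t ^ 2) / sin t ^ 2 + 2 * ((sin t ^ 2 + cos t ^ 2) / cos t ^ 2)
noncomputable def Tf (t : ℝ) : ℝ := sin t / cos t
noncomputable def Td (t : ℝ) : ℝ := (sin t ^ 2 + cos t ^ 2) / cos t ^ 2

theorem Sf_deriv (t : ℝ) : HasDerivAt Sf (Sd t) t := by
  have := (hasDerivAt_sin t).mul (hasDerivAt_cos t)
  refine this.congr_deriv ?_
  unfold Sd; ring

theorem Sd_deriv (t : ℝ) : HasDerivAt Sd (-4 * (sin t * cos t)) t := by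
  have := ((hasDerivAt_cos t).mul (hasDerivAt_cos t)).sub
    ((hasDerivAt_sin t).mul (hasDerivAt_sin t))
  refine this.congr_deriv ?_
  ring

theorem Tf_deriv (t : ℝ) (hc : cos t ≠ 0) : HasDerivAt Tf (Td t) t := by
  have := (hasDerivAt_sin t).div (hasDerivAt_cos t) hc
  refine this.congr_deriv ?_
  unfold Td; ring

theorem Gf_deriv (t : ℝ) (hs : sin t ≠ 0) (hc : cos t ≠ 0) : HasDerivAt Gf (Gd t) t := by
  have := ((hasDerivAt_cos t).div (hasDerivAt_sin t) hs).add
    (((hasDerivAt_sin t).div (hasDerivAt_cos t) hc).const_mul 2)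
  refine this.congr_deriv ?_
  unfold Gd; ring

theorem Gd_deriv (t : ℝ) (hs : sin t ≠ 0) (hc : cos t ≠ 0) :
    HasDerivAt Gd (2 * cos t * (sin t ^ 2 + cos t ^ 2) / sin t ^ 3
      + 4 * sin t * (sin t ^ 2 + cos t ^ 2) / cos t ^ 3) t := by
  have h2 : HasDerivAt (fun t => sin t ^ 2 + cos t ^ 2) 0 t := by
    have := ((hasDerivAt_sin t).pow 2).add ((hasDerivAt_cos t).pow 2)
    refine this.congr_deriv ?_
    push_cast; ring
  have := (h2.neg.div ((hasDerivAt_sin t).pow 2) (pow_ne_zero 2 hs)).add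
    ((h2.div ((hasDerivAt_cos t).pow 2) (pow_ne_zero 2 hc)).const_mul 2)
  refine this.congr_deriv ?_
  simp only [Pi.neg_apply, Pi.pow_apply]
  push_cast
  field_simp
  ring

theorem shift_x {f : ℝ → ℝ} {d x : ℝ} (e : ℝ) (h : HasDerivAt f d (x - e)) :
    HasDerivAt (fun x => f (x - e)) d x := by
  simpa using h.comp_sub_const x e

theorem shift_e {f : ℝ → ℝ} {d x : ℝ} (k : ℝ) (h : HasDerivAt f d x) :
    HasDerivAt (fun e => f (x - k * e)) (-k * d) 0 := by
  have h1 : HasDerivAt (fun e : ℝ => x - k * e) (-k) 0 := by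
    simpa using ((hasDerivAt_id (0:ℝ)).const_mul k).const_sub x
  have h2 : HasDerivAt f d (x - k * 0) := by simpa using h
  have := HasDerivAt.comp (0:ℝ) h2 h1
  refine this.congr_deriv ?_
  ring

theorem A_eq (e x : ℝ) : A20V (π / 4) (π / 4 - e) 0 x =
    Sf (x - 1 * e) * (Sf x + Sf (x - 1 / 2 * e)) /
      (Sf x * (Sf (x - 1 * e) + Sf (x - 1 / 2 * e))) := by
  unfold A20V Sf
  rw [show x + (π / 4 - e) + π / 4 = (x - 1 * e) + π / 2 by ring,
    show x + (π / 4 - e) - π / 4 = x - 1 * e by ring,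
    show x + 2 * (π / 4) = x + π / 2 by ring,
    show x + (π / 4 - e - π / 4 + 0) / 2 = x - 1 / 2 * e by ring,
    show x + (π / 4 - e + 3 * (π / 4) + 0) / 2 = (x - 1 / 2 * e) + π / 2 by ring]
  simp only [sin_add_pi_div_two]
  rw [div_mul_div_comm]
  congr 1 <;> ring

theorem two_cot (t : ℝ) : 2 * cot (2 * t) = cos t / sin t - sin t / cos t := by
  rw [cot_eq_cos_div_sin, sin_two_mul, cos_two_mul']
  by_cases hs : sin t = 0
  · simp [hs]
  by_cases hc : cos t = 0
  · simp [hc]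
  field_simp

theorem kappa_eq (e x : ℝ) : kappa20V (π / 4) (π / 4 - e) 0 x =
    (Gf (x - 1 * e) - Tf x) * (Sf (x - 1 * e) * Sf (x - 1 / 2 * e)) /
      (Sf (x - 1 * e) + Sf (x - 1 / 2 * e)) := by
  unfold kappa20V
  have hp : π / (π - 2 * (π / 4)) = 2 := by
    have := pi_ne_zero
    field_simp
    norm_num
  rw [hp, show x + (π / 4 - e) + π / 4 = (x - 1 * e) + π / 2 by ring,
    show x + (π / 4 - e) - π / 4 = x - 1 * e by ring,
    show x + (π / 4 - e - π / 4 + 0) / 2 = x - 1 / 2 * e by ring,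
    show x + (π / 4 - e + 3 * (π / 4) + 0) / 2 = (x - 1 / 2 * e) + π / 2 by ring,
    show 2 * (π / 4) = π / 2 by ring, two_cot, two_cot]
  simp only [cot_eq_cos_div_sin, sin_add_pi_div_two, cos_add_pi_div_two, sin_pi_div_two, one_mul]
  unfold Gf Tf Sf
  rw [neg_div]
  congr 1 <;> ring

/-- `∂κ/∂ξ` -/
noncomputable def Kd (x e : ℝ) : ℝ :=
  (((Gd (x - 1 * e) - Td x) * (Sf (x - 1 * e) * Sf (x - 1 / 2 * e)) +
    (Gf (x - 1 * e) - Tf x) * (Sd (x - 1 * e) * Sf (x - 1 / 2 * e) +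
      Sf (x - 1 * e) * Sd (x - 1 / 2 * e))) * (Sf (x - 1 * e) + Sf (x - 1 / 2 * e)) -
   (Gf (x - 1 * e) - Tf x) * (Sf (x - 1 * e) * Sf (x - 1 / 2 * e)) *
     (Sd (x - 1 * e) + Sd (x - 1 / 2 * e))) / (Sf (x - 1 * e) + Sf (x - 1 / 2 * e)) ^ 2

/-- `∂A/∂ξ` -/
noncomputable def Ad (x e : ℝ) : ℝ :=
  ((Sd (x - 1 * e) * (Sf x + Sf (x - 1 / 2 * e)) +
    Sf (x - 1 * e) * (Sd x + Sd (x - 1 / 2 * e))) *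
      (Sf x * (Sf (x - 1 * e) + Sf (x - 1 / 2 * e))) -
   Sf (x - 1 * e) * (Sf x + Sf (x - 1 / 2 * e)) *
    (Sd x * (Sf (x - 1 * e) + Sf (x - 1 / 2 * e)) +
      Sf x * (Sd (x - 1 * e) + Sd (x - 1 / 2 * e)))) /
  (Sf x * (Sf (x - 1 * e) + Sf (x - 1 / 2 * e))) ^ 2

theorem kappa_deriv (x e : ℝ) (hc : cos x ≠ 0) (hs1 : sin (x - 1 * e) ≠ 0)
    (hc1 : cos (x - 1 * e) ≠ 0) (h : Sf (x - 1 * e) + Sf (x - 1 / 2 * e) ≠ 0) :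
    deriv (kappa20V (π / 4) (π / 4 - e) 0) x = Kd x e := by
  rw [show kappa20V (π / 4) (π / 4 - e) 0 = _ from funext (kappa_eq e)]
  have ha := shift_x (1 * e) (Sf_deriv (x - 1 * e))
  have hm := shift_x (1 / 2 * e) (Sf_deriv (x - 1 / 2 * e))
  have hg := shift_x (1 * e) (Gf_deriv (x - 1 * e) hs1 hc1)
  exact (((hg.sub (Tf_deriv x hc)).mul (ha.mul hm)).div (ha.add hm) h).deriv

theorem A_deriv (x e : ℝ) (hb : Sf x ≠ 0) (h : Sf (x - 1 * e) + Sf (x - 1 / 2 * e) ≠ 0) :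
    deriv (A20V (π / 4) (π / 4 - e) 0) x = Ad x e := by
  rw [show A20V (π / 4) (π / 4 - e) 0 = _ from funext (A_eq e)]
  have ha := shift_x (1 * e) (Sf_deriv (x - 1 * e))
  have hm := shift_x (1 / 2 * e) (Sf_deriv (x - 1 / 2 * e))
  have hb' := Sf_deriv x
  exact ((ha.mul (hb'.add hm)).div (hb'.mul (ha.add hm)) (mul_ne_zero hb h)).deriv

theorem Kd_zero (x : ℝ) (hs : sin x ≠ 0) (hc : cos x ≠ 0) : Kd x 0 = 0 := by
  unfold Kd Gd Td Gf Tf Sf Sd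
  simp only [mul_zero, sub_zero]
  field_simp
  ring

theorem Ad_zero (x : ℝ) : Ad x 0 = 0 := by
  unfold Ad
  simp only [mul_zero, sub_zero]
  rw [div_eq_zero_iff]
  left
  ring

theorem Ad_e (x : ℝ) (hs : sin x ≠ 0) (hc : cos x ≠ 0) :
    HasDerivAt (Ad x) ((sin x ^ 2 + cos x ^ 2) ^ 2 / (2 * sin x ^ 2 * cos x ^ 2)) 0 := by
  have ha := shift_e 1 (Sf_deriv x)
  have hm := shift_e (1 / 2) (Sf_deriv x)
  have ha' := shift_e 1 (Sd_deriv x)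
  have hm' := shift_e (1 / 2) (Sd_deriv x)
  have hn := ((ha'.mul (hm.const_add (Sf x))).add (ha.mul (hm'.const_add (Sd x)))).mul
      ((ha.add hm).const_mul (Sf x))
  have hn2 := (ha.mul (hm.const_add (Sf x))).mul
      (((ha.add hm).const_mul (Sd x)).add ((ha'.add hm').const_mul (Sf x)))
  have hd := ((ha.add hm).const_mul (Sf x)).pow 2
  have := (hn.sub hn2).div hd (by
    simp only [Pi.pow_apply, Pi.add_apply, mul_zero, sub_zero]
    unfold Sf
    rw [← two_mul]
    positivity)
  refine this.congr_deriv ?_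
  simp only [Pi.pow_apply, Pi.add_apply, Pi.mul_apply, Pi.sub_apply, mul_zero, sub_zero]
  unfold Sf Sd
  push_cast
  field_simp
  ring

theorem Kd_e (x : ℝ) (hs : sin x ≠ 0) (hc : cos x ≠ 0) :
    HasDerivAt (Kd x) (-(cos x ^ 2 + 5 * sin x ^ 2) * (sin x ^ 2 + cos x ^ 2) ^ 2 /
      (8 * sin x ^ 2 * cos x ^ 2)) 0 := by
  have ha := shift_e 1 (Sf_deriv x)
  have hm := shift_e (1 / 2) (Sf_deriv x)
  have ha' := shift_e 1 (Sd_deriv x)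
  have hm' := shift_e (1 / 2) (Sd_deriv x)
  have hg := (shift_e 1 (Gf_deriv x hs hc)).sub_const (Tf x)
  have hg' := (shift_e 1 (Gd_deriv x hs hc)).sub_const (Td x)
  have hn := ((hg'.mul (ha.mul hm)).add (hg.mul ((ha'.mul hm).add (ha.mul hm')))).mul (ha.add hm)
  have hn2 := (hg.mul (ha.mul hm)).mul (ha'.add hm')
  have hd := (ha.add hm).pow 2
  have := (hn.sub hn2).div hd (by
    simp only [Pi.pow_apply, Pi.add_apply, mul_zero, sub_zero]
    unfold Sf
    rw [← two_mul]
    positivity)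
  refine this.congr_deriv ?_
  simp only [Pi.pow_apply, Pi.add_apply, Pi.mul_apply, Pi.sub_apply, mul_zero, sub_zero]
  unfold Sf Sd Gf Gd Tf Td
  push_cast
  field_simp
  ring

/-- In the free-fermion case `η = π/4`, `μ = 0`, the NE
arctic-curve parametrization degenerates to a straight segment as `λ → π/4⁻`:
for every `ξ ∈ (0, π/2)`, `X_NE(ξ) → (2cos(2ξ) - 3)/4` and
`Y_NE(ξ) → (5 - 2cos(2ξ))/4`. -/
theorem NE_branch_free_fermion_segment (ξ : ℝ) (h0 : 0 < ξ) (h1 : ξ < π / 2) :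
    Tendsto (fun ε : ℝ => Xne (π / 4) (π / 4 - ε) 0 ξ) (𝓝[>] 0)
      (𝓝 ((2 * cos (2 * ξ) - 3) / 4)) ∧
    Tendsto (fun ε : ℝ => Yne (π / 4) (π / 4 - ε) 0 ξ) (𝓝[>] 0)
      (𝓝 ((5 - 2 * cos (2 * ξ)) / 4)) := by
  have hs : 0 < sin ξ := sin_pos_of_pos_of_lt_pi h0 (by linarith [pi_pos])
  have hc : 0 < cos ξ := cos_pos_of_mem_Ioo ⟨by linarith [pi_pos], h1⟩
  have hS : 0 < Sf ξ := mul_pos hs hc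
  have hev : ∀ᶠ e in 𝓝[>] (0:ℝ), 0 < e ∧ e < ξ := by
    filter_upwards [Ioo_mem_nhdsGT h0] with e he using he
  have hX : Tendsto (fun ε : ℝ => Xne (π / 4) (π / 4 - ε) 0 ξ) (𝓝[>] 0)
      (𝓝 ((2 * cos (2 * ξ) - 3) / 4)) := by
    have hK := (hasDerivAt_iff_tendsto_slope.1 (Kd_e ξ hs.ne' hc.ne')).mono_left
      (nhdsWithin_mono (0:ℝ) (fun x (hx : 0 < x) => hx.ne'))
    have hA := (hasDerivAt_iff_tendsto_slope.1 (Ad_e ξ hs.ne' hc.ne')).mono_left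
      (nhdsWithin_mono (0:ℝ) (fun x (hx : 0 < x) => hx.ne'))
    have hQ := hK.div hA (by positivity)
    have hval : -(cos ξ ^ 2 + 5 * sin ξ ^ 2) * (sin ξ ^ 2 + cos ξ ^ 2) ^ 2 /
      (8 * sin ξ ^ 2 * cos ξ ^ 2) / ((sin ξ ^ 2 + cos ξ ^ 2) ^ 2 / (2 * sin ξ ^ 2 * cos ξ ^ 2))
        = (2 * cos (2 * ξ) - 3) / 4 := by
      rw [sin_sq_add_cos_sq, cos_two_mul, sin_sq]
      have : 1 - cos ξ ^ 2 ≠ 0 := by rw [← sin_sq]; positivity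
      field_simp
      ring
    rw [hval] at hQ
    refine hQ.congr' ?_
    filter_upwards [hev] with e he
    have hs1 : 0 < sin (ξ - 1 * e) :=
      sin_pos_of_pos_of_lt_pi (by linarith) (by linarith [pi_pos])
    have hc1 : 0 < cos (ξ - 1 * e) := cos_pos_of_mem_Ioo ⟨by linarith [pi_pos], by linarith⟩
    have hs2 : 0 < sin (ξ - 1 / 2 * e) :=
      sin_pos_of_pos_of_lt_pi (by linarith) (by linarith [pi_pos])
    have hc2 : 0 < cos (ξ - 1 / 2 * e) := cos_pos_of_mem_Ioo ⟨by linarith [pi_pos], by linarith⟩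
    have h : Sf (ξ - 1 * e) + Sf (ξ - 1 / 2 * e) ≠ 0 := by
      unfold Sf; positivity
    unfold Xne
    rw [kappa_deriv ξ e hc.ne' hs1.ne' hc1.ne' h, A_deriv ξ e hS.ne' h]
    simp only [Pi.div_apply, slope_def_field, Kd_zero ξ hs.ne' hc.ne', Ad_zero, sub_zero]
    rw [div_div_div_cancel_right₀ he.1.ne']
  refine ⟨hX, ?_⟩
  have ha := (shift_e 1 (Sf_deriv ξ)).continuousAt
  have hm := (shift_e (1 / 2) (Sf_deriv ξ)).continuousAt
  have hg := (shift_e 1 (Gf_deriv ξ hs.ne' hc.ne')).continuousAt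
  have hne : Sf (ξ - 1 * 0) + Sf (ξ - 1 / 2 * 0) ≠ 0 := by
    simp only [mul_zero, sub_zero]; positivity
  have hA : Tendsto (fun e : ℝ => A20V (π / 4) (π / 4 - e) 0 ξ) (𝓝[>] 0) (𝓝 1) := by
    simp only [A_eq]
    have : ContinuousAt (fun e => Sf (ξ - 1 * e) * (Sf ξ + Sf (ξ - 1 / 2 * e)) /
      (Sf ξ * (Sf (ξ - 1 * e) + Sf (ξ - 1 / 2 * e)))) 0 :=
      (ha.mul (continuousAt_const.add hm)).div (continuousAt_const.mul (ha.add hm))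
        (mul_ne_zero hS.ne' hne)
    have h3 := this.tendsto.mono_left (nhdsWithin_le_nhds (s := Set.Ioi 0))
    convert h3 using 2
    simp only [mul_zero, sub_zero]
    field_simp
  have hk : Tendsto (fun e : ℝ => kappa20V (π / 4) (π / 4 - e) 0 ξ) (𝓝[>] 0) (𝓝 (1 / 2)) := by
    simp only [kappa_eq]
    have : ContinuousAt (fun e => (Gf (ξ - 1 * e) - Tf ξ) * (Sf (ξ - 1 * e) *
      Sf (ξ - 1 / 2 * e)) / (Sf (ξ - 1 * e) + Sf (ξ - 1 / 2 * e))) 0 :=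
      ((hg.sub continuousAt_const).mul (ha.mul hm)).div (ha.add hm) hne
    have h3 := this.tendsto.mono_left (nhdsWithin_le_nhds (s := Set.Ioi 0))
    convert h3 using 2
    simp only [mul_zero, sub_zero]
    unfold Gf Tf Sf
    have h5 := sin_sq_add_cos_sq ξ
    field_simp
    linear_combination (-2) * h5
  have := hk.sub (hA.mul hX)
  unfold Yne
  convert this using 2
  ring
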